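/- Let n ≥ 2, let D ⊆ ℝⁿ be open, let K ⊆ D be compact, and let 𝔉 be a family of mappings f : D → ℝⁿ, each of which is continuous, injective, and an open map (equivalently, a homeomorphism of D onto an open image). Suppose 𝔉 is uniformly light on K: for every ε > 0 there is δ = δ(ε, K) > 0 such that diam(f(C)) ≥ δ for every f ∈ 𝔉 and every continuum C ⊆ K with diam(C) ≥ ε. Then 𝔉 is uniformly open on K: for every ε₀ > 0 there exists r₀ = r₀(K, ε₀) > 0 such that for every f ∈ 𝔉 and every x₀ with the closed ball B̄(x₀, ε₀) contained in K, the open ball B(f(x₀), r₀) is contained in f(B(x₀, ε₀)). -/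

import Mathlib

open Metric Set

/-- If `f` is continuous and injective on a compact set `s`, then the preimage in `s` of a
continuum contained in `f '' s` is a continuum. -/
theorem isCompact_isConnected_inter_preimage {X Y : Type*} [TopologicalSpace X]
    [TopologicalSpace Y] [T2Space Y] {f : X → Y} {s : Set X} {t : Set Y} (hs : IsCompact s)
    (hf : ContinuousOn f s) (hinj : InjOn f s) (ht : IsCompact t) (htc : IsConnected t)
    (hts : t ⊆ f '' s) :
    IsCompact (s ∩ f ⁻¹' t) ∧ IsConnected (s ∩ f ⁻¹' t) := by
  have : CompactSpace s := isCompact_iff_compactSpace.mp hs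
  have hfc : Continuous (s.domRestrict f) := continuousOn_iff_continuous_domRestrict.mp hf
  have heq : s ∩ f ⁻¹' t = Subtype.val '' (s.domRestrict f ⁻¹' t) := by
    ext x
    simp [Set.domRestrict, and_comm]
  rw [heq]
  refine ⟨(ht.isClosed.preimage hfc).isCompact.image continuous_subtype_val,
    IsConnected.image (htc.preimage_of_isClosedMap hinj.injective hfc.isClosedMap ?_) _
      continuous_subtype_val.continuousOn⟩
  rwa [range_domRestrict]

/-- A segment from a point of an open set `U` to a point outside `U` has an initial piece that
lies in the closure of `U` and ends outside `U`. -/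
theorem exists_lineMap_notMem_of_isOpen {E : Type*} [NormedAddCommGroup E] [NormedSpace ℝ E]
    {U : Set E} (hU : IsOpen U) {p q : E} (hp : p ∈ U) (hq : q ∉ U) :
    ∃ t ∈ Icc (0 : ℝ) 1, AffineMap.lineMap p q t ∉ U ∧
      AffineMap.lineMap p q '' Icc 0 t ⊆ closure U := by
  have hγ : Continuous (AffineMap.lineMap p q : ℝ → E) := AffineMap.lineMap_continuous
  have hcomp : IsCompact (Icc (0 : ℝ) 1 ∩ (AffineMap.lineMap p q) ⁻¹' Uᶜ) :=
    isCompact_Icc.inter_right (hU.isClosed_compl.preimage hγ)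
  obtain ⟨t, ⟨ht, htU⟩, hmin⟩ := hcomp.exists_isLeast ⟨1, by simp, by simpa using hq⟩
  refine ⟨t, ht, htU, ?_⟩
  have ht0 : (0 : ℝ) ≠ t := by
    rintro rfl
    exact htU (by simpa using hp)
  rw [← closure_Ico ht0]
  refine (image_closure_subset_closure_image hγ).trans (closure_mono ?_)
  rintro _ ⟨u, hu, rfl⟩
  by_contra hc
  exact absurd (hmin ⟨⟨hu.1, hu.2.le.trans ht.2⟩, hc⟩) (not_le.mpr hu.2)

/-- A uniformly light family of homeomorphisms (continuous, injective, open mappings) of an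
open set `D ⊆ ℝⁿ` is uniformly open on a compact set `K ⊆ D`: images of balls `B(x₀, ε₀)`
with `B̄(x₀, ε₀) ⊆ K` contain balls of a fixed radius `r₀ > 0` around `f x₀`. -/
theorem uniformly_open_of_uniformly_light
    (n : ℕ) (hn : 2 ≤ n)
    (D K : Set (EuclideanSpace ℝ (Fin n))) (hD : IsOpen D)
    (hKD : K ⊆ D) (hK : IsCompact K)
    (𝔉 : Set (EuclideanSpace ℝ (Fin n) → EuclideanSpace ℝ (Fin n)))
    (hcont : ∀ f ∈ 𝔉, ContinuousOn f D)
    (hinj : ∀ f ∈ 𝔉, Set.InjOn f D)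
    (hopen : ∀ f ∈ 𝔉, ∀ U : Set (EuclideanSpace ℝ (Fin n)), U ⊆ D → IsOpen U →
      IsOpen (f '' U))
    (hlight : ∀ ε : ℝ, 0 < ε → ∃ δ : ℝ, 0 < δ ∧
      ∀ f ∈ 𝔉, ∀ C : Set (EuclideanSpace ℝ (Fin n)), C ⊆ K → IsCompact C →
        IsConnected C → ε ≤ Metric.diam C → δ ≤ Metric.diam (f '' C)) :
    ∀ ε₀ : ℝ, 0 < ε₀ → ∃ r₀ : ℝ, 0 < r₀ ∧
      ∀ f ∈ 𝔉, ∀ x₀ : EuclideanSpace ℝ (Fin n), Metric.closedBall x₀ ε₀ ⊆ K →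
        Metric.ball (f x₀) r₀ ⊆ f '' (Metric.ball x₀ ε₀) := by
  intro ε₀ hε₀
  obtain ⟨δ, hδ, hlight⟩ := hlight ε₀ hε₀
  refine ⟨δ, hδ, fun f hf x₀ hx₀ y hy => ?_⟩
  by_contra hyU
  have hBD : closedBall x₀ ε₀ ⊆ D := hx₀.trans hKD
  have hB : IsCompact (closedBall x₀ ε₀) := isCompact_closedBall x₀ ε₀
  have hfB : ContinuousOn f (closedBall x₀ ε₀) := (hcont f hf).mono hBD
  have hU : IsOpen (f '' ball x₀ ε₀) :=
    hopen f hf _ (ball_subset_closedBall.trans hBD) isOpen_ball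
  obtain ⟨t, ht, htU, hcl⟩ :=
    exists_lineMap_notMem_of_isOpen hU (mem_image_of_mem f (mem_ball_self hε₀)) hyU
  set γ : ℝ →ᵃ[ℝ] EuclideanSpace ℝ (Fin n) := AffineMap.lineMap (f x₀) y with hγ_def
  have hγ : Continuous γ := AffineMap.lineMap_continuous
  have hsub : γ '' Icc 0 t ⊆ f '' closedBall x₀ ε₀ :=
    hcl.trans (closure_minimal (image_mono ball_subset_closedBall)
      (hB.image_of_continuousOn hfB).isClosed)
  obtain ⟨hCcomp, hCconn⟩ := isCompact_isConnected_inter_preimage hB hfB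
    ((hinj f hf).mono hBD) (isCompact_Icc.image hγ)
    ((isConnected_Icc ht.1).image γ hγ.continuousOn) hsub
  obtain ⟨z, hz, hzt⟩ := hsub (mem_image_of_mem γ (right_mem_Icc.mpr ht.1))
  have hzx : ε₀ ≤ dist z x₀ := by
    by_contra! hlt
    exact htU (hzt ▸ mem_image_of_mem f hlt)
  have hdiam : ε₀ ≤ diam (closedBall x₀ ε₀ ∩ f ⁻¹' (γ '' Icc 0 t)) :=
    hzx.trans <| dist_le_diam_of_mem hCcomp.isBounded ⟨hz, t, right_mem_Icc.mpr ht.1, hzt.symm⟩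
      ⟨mem_closedBall_self hε₀.le, 0, left_mem_Icc.mpr ht.1, by simp [hγ_def]⟩
  refine absurd (hlight f hf _ (inter_subset_left.trans hx₀) hCcomp hCconn hdiam)
    (not_le.mpr (lt_of_le_of_lt ?_ (mem_ball'.mp hy)))
  refine diam_le_of_forall_dist_le dist_nonneg ?_
  rintro _ ⟨a, ⟨-, u, hu, hua⟩, rfl⟩ _ ⟨b, ⟨-, v, hv, hvb⟩, rfl⟩
  rw [← hua, ← hvb, hγ_def, dist_lineMap_lineMap]
  refine mul_le_of_le_one_left dist_nonneg ?_
  rw [Real.dist_eq, abs_le]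
  constructor <;> linarith [hu.1, hu.2, hv.1, hv.2, ht.2]
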